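/- Let Π be a closed and strictly positive set of distributions on {0,1}^p, let r be a quota rule and f a logical connection, and suppose condition κ4 fails. Then there exists a constant c > 0, depending only on Π, q, d, and f, such that for every n ≥ 1 for which both condition κ1(n) and condition κ3(n) fail, DP^min(n) ≥ c. -/

import Mathlib

/-- A judgement on `p` premises: a vector in `{0,1}^p`, encoded as `Fin p → Bool`. -/
abbrev Judg (p : ℕ) : Type := Fin p → Bool

noncomputable section

/-- `Ω_i`: for a premise index `i < p`, the set of judgements whose `i`-th premise is `1`;
for the conclusion index `i = p`, the set of judgements `ω` with `f ω = 1`. -/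
def Omega (p : ℕ) (f : Judg p → Bool) (i : Fin (p + 1)) : Finset (Judg p) :=
  if h : (i : ℕ) < p then Finset.univ.filter (fun ω => ω ⟨(i : ℕ), h⟩ = true)
  else Finset.univ.filter (fun ω => f ω = true)

/-- The vector `c_i ∈ ℝ^({0,1}^p)`: `c_i(ω) = q_i - 1` if `ω ∈ Ω_i`, else `q_i`. -/
def cvec (p : ℕ) (f : Judg p → Bool) (q : Fin (p + 1) → ℝ) (i : Fin (p + 1)) :
    Judg p → ℝ :=
  fun ω => if ω ∈ Omega p f i then q i - 1 else q i

/-- Euclidean inner product on `ℝ^({0,1}^p)`. -/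
def inn (p : ℕ) (u v : Judg p → ℝ) : ℝ := ∑ ω : Judg p, u ω * v ω

/-- The histogram of a profile: how many agents cast each judgement. -/
def Hist (p n : ℕ) (P : Fin n → Judg p) (ω : Judg p) : ℕ :=
  (Finset.univ.filter (fun j => P j = ω)).card

/-- The histogram, viewed as a vector in `ℝ^({0,1}^p)`. -/
def HistR (p n : ℕ) (P : Fin n → Judg p) : Judg p → ℝ :=
  fun ω => (Hist p n P ω : ℝ)

/-- `n_i(P)`: the number of agents of `P` whose judgement lies in `Ω_i`. -/
def nOnes (p n : ℕ) (f : Judg p → Bool) (P : Fin n → Judg p) (i : Fin (p + 1)) : ℕ :=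
  ∑ ω ∈ Omega p f i, Hist p n P ω

/-- The quota rule on profiles, with thresholds `q` and tie-breakings `d`. -/
def quota (p n : ℕ) (f : Judg p → Bool) (q : Fin (p + 1) → ℝ) (d : Fin (p + 1) → Bool)
    (P : Fin n → Judg p) (i : Fin (p + 1)) : Bool := by
  classical
  exact if (nOnes p n f P i : ℝ) > q i * (n : ℝ) then true
    else if (nOnes p n f P i : ℝ) = q i * (n : ℝ) then d i
    else false

/-- The real value of a bit: `1` for `1`/true, `0` for `0`/false. -/
def bval (b : Bool) : ℝ := if b then 1 else 0

/-- `sign(1) = 1` and `sign(0) = -1`. -/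
def sgn (b : Bool) : ℝ := if b then 1 else -1

/-- `α ∈ {0,1}^{p+1}` is consistent if its conclusion component equals `f` applied to
its premise components. -/
def Consistent (p : ℕ) (f : Judg p → Bool) (α : Fin (p + 1) → Bool) : Prop :=
  α (Fin.last p) = f (fun j => α j.castSucc)

/-- A profile is a doctrinal paradox if the quota-rule output is inconsistent. -/
def Paradox (p n : ℕ) (f : Judg p → Bool) (q : Fin (p + 1) → ℝ) (d : Fin (p + 1) → Bool)
    (P : Fin n → Judg p) : Prop :=
  ¬ Consistent p f (quota p n f q d P)

/-- The polyhedron `H_α`. -/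
def polyH (p : ℕ) (f : Judg p → Bool) (q : Fin (p + 1) → ℝ) (d : Fin (p + 1) → Bool)
    (α : Fin (p + 1) → Bool) : Set (Judg p → ℝ) :=
  {x | ∀ i : Fin (p + 1),
    sgn (α i) * inn p (cvec p f q i) x ≤ sgn (α i) * bval (d i) - bval (α i)}

/-- The characteristic cone `H_{α,≤0}`. -/
def coneH (p : ℕ) (f : Judg p → Bool) (q : Fin (p + 1) → ℝ)
    (α : Fin (p + 1) → Bool) : Set (Judg p → ℝ) :=
  {x | ∀ i : Fin (p + 1), sgn (α i) * inn p (cvec p f q i) x ≤ 0}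

/-- A probability distribution on `{0,1}^p`. -/
def IsDistribution (p : ℕ) (π : Judg p → ℝ) : Prop :=
  (∀ ω, 0 ≤ π ω) ∧ ∑ ω : Judg p, π ω = 1

/-- `pr_i(π) = Σ_{ω ∈ Ω_i} π(ω)`. -/
def pr (p : ℕ) (f : Judg p → Bool) (π : Judg p → ℝ) (i : Fin (p + 1)) : ℝ :=
  ∑ ω ∈ Omega p f i, π ω

/-- The quota rule applied to a distribution. -/
def quotaDist (p : ℕ) (f : Judg p → Bool) (q : Fin (p + 1) → ℝ) (d : Fin (p + 1) → Bool)
    (π : Judg p → ℝ) (i : Fin (p + 1)) : Bool := by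
  classical
  exact if pr p f π i > q i then true
    else if pr p f π i = q i then d i
    else false

/-- `α` is a refinement of `π`: it matches `r(π)` on every non-tied proposition. -/
def Refines (p : ℕ) (f : Judg p → Bool) (q : Fin (p + 1) → ℝ) (d : Fin (p + 1) → Bool)
    (π : Judg p → ℝ) (α : Fin (p + 1) → Bool) : Prop :=
  ∀ i : Fin (p + 1), pr p f π i ≠ q i → α i = quotaDist p f q d π i

/-- `α` is an effective refinement of `π` at `n`: a refinement realized by some profile. -/
def EffRef (p n : ℕ) (f : Judg p → Bool) (q : Fin (p + 1) → ℝ) (d : Fin (p + 1) → Bool)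
    (π : Judg p → ℝ) (α : Fin (p + 1) → Bool) : Prop :=
  Refines p f q d π α ∧ ∃ P : Fin n → Judg p, quota p n f q d P = α

/-- The probability that a random profile drawn from the independent (non-identical)
product of `vπ` is a doctrinal paradox. -/
def probParadox (p n : ℕ) (f : Judg p → Bool) (q : Fin (p + 1) → ℝ)
    (d : Fin (p + 1) → Bool) (vπ : Fin n → Judg p → ℝ) : ℝ := by
  classical
  exact ∑ P : Fin n → Judg p,
    if Paradox p n f q d P then ∏ j : Fin n, vπ j (P j) else 0

/-- The max-smoothed likelihood of the doctrinal paradox. -/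
def DPmax (p n : ℕ) (f : Judg p → Bool) (q : Fin (p + 1) → ℝ) (d : Fin (p + 1) → Bool)
    (D : Set (Judg p → ℝ)) : ℝ :=
  sSup {x : ℝ | ∃ vπ : Fin n → Judg p → ℝ,
    (∀ j, vπ j ∈ D) ∧ x = probParadox p n f q d vπ}

/-- The min-smoothed likelihood of the doctrinal paradox. -/
def DPmin (p n : ℕ) (f : Judg p → Bool) (q : Fin (p + 1) → ℝ) (d : Fin (p + 1) → Bool)
    (D : Set (Judg p → ℝ)) : ℝ :=
  sInf {x : ℝ | ∃ vπ : Fin n → Judg p → ℝ,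
    (∀ j, vπ j ∈ D) ∧ x = probParadox p n f q d vπ}

/-- Condition `κ1(n)`: no profile of `n` agents is a doctrinal paradox. -/
def kappa1 (p n : ℕ) (f : Judg p → Bool) (q : Fin (p + 1) → ℝ)
    (d : Fin (p + 1) → Bool) : Prop :=
  ∀ P : Fin n → Judg p, ¬ Paradox p n f q d P

/-- Condition `κ2(n)`: every effective refinement at `n` of every `π` in the convex hull
of `D` is consistent. -/
def kappa2 (p n : ℕ) (f : Judg p → Bool) (q : Fin (p + 1) → ℝ) (d : Fin (p + 1) → Bool)
    (D : Set (Judg p → ℝ)) : Prop :=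
  ∀ π ∈ convexHull ℝ D, ∀ α : Fin (p + 1) → Bool,
    EffRef p n f q d π α → Consistent p f α

/-- Condition `κ3(n)`: some `π` in the convex hull of `D` has all its effective
refinements at `n` consistent. -/
def kappa3 (p n : ℕ) (f : Judg p → Bool) (q : Fin (p + 1) → ℝ) (d : Fin (p + 1) → Bool)
    (D : Set (Judg p → ℝ)) : Prop :=
  ∃ π ∈ convexHull ℝ D, ∀ α : Fin (p + 1) → Bool,
    EffRef p n f q d π α → Consistent p f α

/-- Condition `κ4`: the conclusion depends on exactly one premise, with matching
thresholds. -/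
def kappa4 (p : ℕ) (f : Judg p → Bool) (q : Fin (p + 1) → ℝ) : Prop :=
  ∃ i : Fin p,
    ((∀ ω : Judg p, f ω = ω i) ∧ q (Fin.last p) = q i.castSucc) ∨
    ((∀ ω : Judg p, f ω = !(ω i)) ∧ q (Fin.last p) = 1 - q i.castSucc)

/-- `D` is strictly positive: some `ε > 0` lower-bounds every probability. -/
def StrictlyPositive (p : ℕ) (D : Set (Judg p → ℝ)) : Prop :=
  ∃ ε > (0 : ℝ), ∀ π ∈ D, ∀ ω : Judg p, ε ≤ π ω

/-- Second moment of a shifted sum of independent centred variables on a finite product. -/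
theorem sum_prod_mul_add_sum_sq {ι : Type*} [Fintype ι] (n : ℕ) (μ X : Fin n → ι → ℝ)
    (hμ : ∀ j, ∑ ω, μ j ω = 1) (hX : ∀ j, ∑ ω, μ j ω * X j ω = 0) (a : ℝ) :
    ∑ P : Fin n → ι, (∏ j, μ j (P j)) * (a + ∑ j, X j (P j)) ^ 2
      = a ^ 2 + ∑ j, ∑ ω, μ j ω * X j ω ^ 2 := by
  induction n generalizing a with
  | zero => simp
  | succ n ih =>
    rw [← (Fin.consEquiv fun _ => ι).sum_comp, Fintype.sum_prod_type]
    have key : ∀ ω : ι,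
        ∑ P : Fin n → ι, (∏ j, μ j ((Fin.consEquiv fun _ => ι) (ω, P) j)) *
          (a + ∑ j, X j ((Fin.consEquiv fun _ => ι) (ω, P) j)) ^ 2
        = μ 0 ω * ((a + X 0 ω) ^ 2 + ∑ j : Fin n, ∑ ω, μ j.succ ω * X j.succ ω ^ 2) := by
      intro ω
      rw [← ih (fun j => μ j.succ) (fun j => X j.succ) (fun j => hμ _) (fun j => hX _),
        Finset.mul_sum]
      refine Finset.sum_congr rfl fun P _ => ?_
      simp only [Fin.prod_univ_succ, Fin.sum_univ_succ, Fin.consEquiv_apply, Fin.cons_zero,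
        Fin.cons_succ]
      ring
    rw [Finset.sum_congr rfl fun ω _ => key ω, Fin.sum_univ_succ]
    set V := ∑ j : Fin n, ∑ ω, μ j.succ ω * X j.succ ω ^ 2
    have expand : ∀ ω, μ 0 ω * ((a + X 0 ω) ^ 2 + V)
        = μ 0 ω * (a ^ 2 + V) + 2 * a * (μ 0 ω * X 0 ω) + μ 0 ω * X 0 ω ^ 2 := fun ω => by ring
    simp only [expand, Finset.sum_add_distrib, ← Finset.sum_mul, ← Finset.mul_sum, hμ, hX]
    ring

/-- Cauchy–Schwarz comparison of two product measures through their chi-square divergence. -/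
theorem sq_sum_prod_le_sum_prod_mul {ι : Type*} [Fintype ι] {n : ℕ} (A : Finset (Fin n → ι))
    (μ ν : Fin n → ι → ℝ) (hμ : ∀ j ω, 0 < μ j ω) :
    (∑ P ∈ A, ∏ j, ν j (P j)) ^ 2
      ≤ (∑ P ∈ A, ∏ j, μ j (P j)) * ∏ j, ∑ ω, ν j ω ^ 2 / μ j ω := by
  classical
  have hpos : ∀ P : Fin n → ι, 0 ≤ ∏ j, ν j (P j) ^ 2 / μ j (P j) := fun P =>
    Finset.prod_nonneg fun j _ => div_nonneg (sq_nonneg _) (hμ _ _).le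
  have hA : 0 ≤ ∑ P ∈ A, ∏ j, μ j (P j) :=
    Finset.sum_nonneg fun P _ => Finset.prod_nonneg fun j _ => (hμ _ _).le
  calc (∑ P ∈ A, ∏ j, ν j (P j)) ^ 2
      ≤ (∑ P ∈ A, ∏ j, μ j (P j)) * ∑ P ∈ A, ∏ j, ν j (P j) ^ 2 / μ j (P j) := by
        refine Finset.sum_sq_le_sum_mul_sum_of_sq_le_mul A
          (fun P _ => Finset.prod_nonneg fun j _ => (hμ _ _).le) (fun P _ => hpos P) fun P _ => le_of_eq ?_
        rw [← Finset.prod_mul_distrib, ← Finset.prod_pow]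
        exact Finset.prod_congr rfl fun j _ => by field_simp [(hμ j (P j)).ne']
    _ ≤ (∑ P ∈ A, ∏ j, μ j (P j)) * ∏ j, ∑ ω, ν j ω ^ 2 / μ j ω := by
        refine mul_le_mul_of_nonneg_left ?_ hA
        rw [Fintype.prod_sum]
        exact Finset.sum_le_sum_of_subset_of_nonneg (Finset.subset_univ A) fun P _ _ => hpos P

/-- Tilting a positive distribution by a vector of total mass zero. -/
theorem sum_sq_div_tilt_le {ι : Type*} [Fintype ι] {ε B : ℝ} (hε : 0 < ε) {μ v : ι → ℝ} (τ : ℝ)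
    (hμ : ∀ ω, ε ≤ μ ω) (hμ1 : ∑ ω, μ ω = 1) (hv : ∑ ω, v ω = 0) (hB : ∑ ω, |v ω| ≤ B) :
    ∑ ω, (μ ω + τ * v ω) ^ 2 / μ ω ≤ 1 + τ ^ 2 * (B ^ 2 / ε) := by
  have expand : ∀ ω, (μ ω + τ * v ω) ^ 2 / μ ω
      = μ ω + 2 * τ * v ω + τ ^ 2 * (v ω ^ 2 / μ ω) := fun ω => by
    field_simp [(hε.trans_le (hμ ω)).ne']
    ring
  have hsq : ∑ ω, v ω ^ 2 / μ ω ≤ B ^ 2 / ε :=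
    calc ∑ ω, v ω ^ 2 / μ ω ≤ ∑ ω, |v ω| ^ 2 / ε := Finset.sum_le_sum fun ω _ => by
          rw [sq_abs]
          exact div_le_div_of_nonneg_left (sq_nonneg _) hε (hμ ω)
      _ = (∑ ω, |v ω| ^ 2) / ε := by rw [Finset.sum_div]
      _ ≤ B ^ 2 / ε := by
          refine div_le_div_of_nonneg_right ?_ hε.le
          exact (Finset.sum_sq_le_sq_sum_of_nonneg fun ω _ => abs_nonneg (v ω)).trans
            (pow_le_pow_left₀ (Finset.sum_nonneg fun ω _ => abs_nonneg _) hB 2)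
  simp only [expand, Finset.sum_add_distrib, ← Finset.mul_sum, hμ1, hv]
  nlinarith [mul_le_mul_of_nonneg_left hsq (sq_nonneg τ)]

/-- Chebyshev's inequality for finitely many sums of independent `[0,1]`-valued variables: outside
an event `A`, some sum deviates from its mean by at least `R`. -/
theorem one_sub_le_sum_prod {ι κ : Type*} [Fintype ι] [Fintype κ] {n : ℕ} {ν : Fin n → ι → ℝ}
    (hν0 : ∀ j ω, 0 ≤ ν j ω) (hν1 : ∀ j, ∑ ω, ν j ω = 1) {h : κ → ι → ℝ}
    (hh : ∀ i ω, h i ω ∈ Set.Icc (0 : ℝ) 1) {R : ℝ} (hR : 0 < R) (A : Finset (Fin n → ι))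
    (hA : ∀ P ∉ A, ∃ i, R ≤ |∑ j, h i (P j) - ∑ j, ∑ ω, ν j ω * h i ω|) :
    1 - Fintype.card κ * n / R ^ 2 ≤ ∑ P ∈ A, ∏ j, ν j (P j) := by
  classical
  set X : κ → Fin n → ι → ℝ := fun i j ω => h i ω - ∑ ω, ν j ω * h i ω with hXdef
  have hM : ∀ P : Fin n → ι, 0 ≤ ∏ j, ν j (P j) := fun P => Finset.prod_nonneg fun j _ => hν0 _ _
  have htot : ∑ P : Fin n → ι, ∏ j, ν j (P j) = 1 := by
    rw [← Fintype.prod_sum]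
    simp [hν1]
  have hmean : ∀ i j, ∑ ω, ν j ω * X i j ω = 0 := fun i j => by
    simp only [hXdef, mul_sub, Finset.sum_sub_distrib, ← Finset.sum_mul, hν1]
    ring
  have hvar : ∀ i j, ∑ ω, ν j ω * X i j ω ^ 2 ≤ 1 := fun i j => by
    have hm0 : 0 ≤ ∑ ω, ν j ω * h i ω :=
      Finset.sum_nonneg fun ω _ => mul_nonneg (hν0 _ _) (hh _ _).1
    have hm1 : ∑ ω, ν j ω * h i ω ≤ 1 := by
      rw [← hν1 j]
      exact Finset.sum_le_sum fun ω _ => mul_le_of_le_one_right (hν0 _ _) (hh _ _).2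
    calc ∑ ω, ν j ω * X i j ω ^ 2 ≤ ∑ ω, ν j ω := Finset.sum_le_sum fun ω _ => by
          refine mul_le_of_le_one_right (hν0 _ _) ?_
          rw [sq_le_one_iff_abs_le_one, abs_le]
          constructor <;> linarith [(hh i ω).1, (hh i ω).2]
      _ = 1 := hν1 j
  have hmom : ∀ i, ∑ P : Fin n → ι, (∏ j, ν j (P j)) * (∑ j, X i j (P j)) ^ 2 ≤ n := fun i => by
    have := sum_prod_mul_add_sum_sq n ν (X i) hν1 (hmean i) 0
    simp only [zero_add] at this
    rw [this]
    calc (0 : ℝ) ^ 2 + ∑ j, ∑ ω, ν j ω * X i j ω ^ 2 = ∑ j, ∑ ω, ν j ω * X i j ω ^ 2 := by ring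
      _ ≤ ∑ _j : Fin n, (1 : ℝ) := Finset.sum_le_sum fun j _ => hvar i j
      _ = n := by simp
  have hbad : (∑ P ∈ Aᶜ, ∏ j, ν j (P j)) * R ^ 2 ≤ Fintype.card κ * n := by
    calc (∑ P ∈ Aᶜ, ∏ j, ν j (P j)) * R ^ 2
        ≤ ∑ P ∈ Aᶜ, (∏ j, ν j (P j)) * ∑ i, (∑ j, X i j (P j)) ^ 2 := by
          rw [Finset.sum_mul]
          refine Finset.sum_le_sum fun P hP => mul_le_mul_of_nonneg_left ?_ (hM P)
          obtain ⟨i, hi⟩ := hA P (Finset.mem_compl.1 hP)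
          calc R ^ 2 ≤ (∑ j, X i j (P j)) ^ 2 := by
                rw [← sq_abs (∑ j, X i j (P j))]
                refine pow_le_pow_left₀ hR.le ?_ 2
                simpa [hXdef, Finset.sum_sub_distrib] using hi
            _ ≤ _ := Finset.single_le_sum (f := fun i => (∑ j, X i j (P j)) ^ 2)
                (fun _ _ => sq_nonneg _) (Finset.mem_univ i)
      _ ≤ ∑ P : Fin n → ι, (∏ j, ν j (P j)) * ∑ i, (∑ j, X i j (P j)) ^ 2 :=
          Finset.sum_le_sum_of_subset_of_nonneg (Finset.subset_univ _) fun P _ _ =>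
            mul_nonneg (hM P) (Finset.sum_nonneg fun _ _ => sq_nonneg _)
      _ = ∑ i, ∑ P : Fin n → ι, (∏ j, ν j (P j)) * (∑ j, X i j (P j)) ^ 2 := by
          simp only [Finset.mul_sum]
          exact Finset.sum_comm
      _ ≤ ∑ _i : κ, (n : ℝ) := by
          gcongr with i
          exact hmom i
      _ = Fintype.card κ * n := by simp
  have hle : ∑ P ∈ Aᶜ, ∏ j, ν j (P j) ≤ Fintype.card κ * n / R ^ 2 :=
    (le_div_iff₀ (by positivity)).2 hbad
  rw [← htot, ← Finset.sum_add_sum_compl A]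
  linarith

/-- If the mean of every sum lies on the right side of its threshold, and either a common direction
`v` pushes it further or it is already far away, then with probability bounded below all sums lie
strictly on the right side of their thresholds. -/
theorem exists_pos_le_sum_prod_of_drift {ι κ : Type*} [Fintype ι] [Fintype κ] {h : κ → ι → ℝ}
    (hh : ∀ i ω, h i ω ∈ Set.Icc (0 : ℝ) 1) {ε δ B : ℝ} (hε : 0 < ε) (hδ : 0 < δ) :
    ∃ c > (0 : ℝ), ∃ N : ℕ, ∀ n ≥ N, ∀ μ : Fin n → ι → ℝ, (∀ j ω, ε ≤ μ j ω) →
      (∀ j, ∑ ω, μ j ω = 1) → ∀ v : ι → ℝ, ∑ ω, v ω = 0 → ∑ ω, |v ω| ≤ B →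
      ∀ s θ : κ → ℝ, (∀ i, |s i| = 1) →
      (∀ i, 0 ≤ s i * (∑ j, ∑ ω, μ j ω * h i ω - θ i)) →
      (∀ i, 1 ≤ s i * ∑ ω, v ω * h i ω ∨ δ * n ≤ s i * (∑ j, ∑ ω, μ j ω * h i ω - θ i)) →
      ∀ A : Finset (Fin n → ι), (∀ P, (∀ i, 0 < s i * (∑ j, h i (P j) - θ i)) → P ∈ A) →
      c ≤ ∑ P ∈ A, ∏ j, μ j (P j) := by
  set T : ℝ := 2 * (Fintype.card κ + 1) with hT
  have hT0 : 0 < T := by positivity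
  refine ⟨Real.exp (-(T ^ 2 * (B ^ 2 / ε))) / 4, by positivity,
    ⌈(T * (B + 1) / δ) ^ 2 + (T * B / ε) ^ 2 + 1⌉₊, ?_⟩
  intro n hn μ hμ hμ1 v hv hvB s θ hs hpos hdrift A hA
  have hn' := (Nat.le_ceil _).trans (Nat.cast_le (α := ℝ).2 hn)
  have hn1 : (1 : ℝ) ≤ n := by nlinarith [sq_nonneg (T * (B + 1) / δ), sq_nonneg (T * B / ε)]
  set r := √(n : ℝ)
  have hr0 : 0 < r := Real.sqrt_pos.2 (by linarith)
  have hrr : r * r = n := Real.mul_self_sqrt (by linarith)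
  have hrδ : T * (B + 1) ≤ δ * r := by
    have : T * (B + 1) / δ ≤ r := Real.le_sqrt_of_sq_le (by nlinarith [sq_nonneg (T * B / ε)])
    rwa [div_le_iff₀' hδ] at this
  have hrε : T * B ≤ ε * r := by
    have : T * B / ε ≤ r := Real.le_sqrt_of_sq_le (by nlinarith [sq_nonneg (T * (B + 1) / δ)])
    rwa [div_le_iff₀' hε] at this
  have hnτ : (n : ℝ) * (T / r) = T * r := by rw [← hrr]; field_simp
  set ν : Fin n → ι → ℝ := fun j ω => μ j ω + T / r * v ω with hν
  have hν0 : ∀ j ω, 0 ≤ ν j ω := fun j ω => by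
    have hvω : |v ω| ≤ B := (Finset.single_le_sum (f := fun ω => |v ω|)
      (fun _ _ => abs_nonneg _) (Finset.mem_univ ω)).trans hvB
    have : T / r * |v ω| ≤ ε := by
      rw [div_mul_eq_mul_div, div_le_iff₀ hr0]
      exact (mul_le_mul_of_nonneg_left hvω hT0.le).trans hrε
    have := mul_le_mul_of_nonneg_left (neg_abs_le (v ω)) (div_pos hT0 hr0).le
    simp only [hν]
    linarith [hμ j ω]
  have hν1 : ∀ j, ∑ ω, ν j ω = 1 := fun j => by
    simp [hν, Finset.sum_add_distrib, hμ1, ← Finset.mul_sum, hv]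
  have hνmean : ∀ i, ∑ j, ∑ ω, ν j ω * h i ω
      = ∑ j, ∑ ω, μ j ω * h i ω + T * r * ∑ ω, v ω * h i ω := fun i => by
    simp only [hν, add_mul, Finset.sum_add_distrib, mul_assoc, ← Finset.mul_sum]
    rw [Finset.sum_const, Finset.card_univ, Fintype.card_fin, nsmul_eq_mul]
    linear_combination (∑ ω, v ω * h i ω) * hnτ
  have hfar : ∀ i, T * r ≤ s i * (∑ j, ∑ ω, ν j ω * h i ω - θ i) := fun i => by
    rw [hνmean, add_sub_right_comm, mul_add, mul_left_comm (s i) (T * r)]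
    rcases hdrift i with h1 | h2
    · have := mul_le_mul_of_nonneg_left h1 (mul_pos hT0 hr0).le
      linarith [hpos i]
    · have hvh : |s i * ∑ ω, v ω * h i ω| ≤ B := by
        rw [abs_mul, hs, one_mul]
        refine ((Finset.abs_sum_le_sum_abs _ _).trans (Finset.sum_le_sum fun ω _ => ?_)).trans hvB
        rw [abs_mul, abs_of_nonneg (hh i ω).1]
        exact mul_le_of_le_one_right (abs_nonneg _) (hh i ω).2
      have h3 := mul_le_mul_of_nonneg_left (abs_le.1 hvh).1 (mul_pos hT0 hr0).le
      have h4 := mul_le_mul_of_nonneg_right hrδ hr0.le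
      rw [mul_assoc δ, hrr] at h4
      nlinarith
  have hhalf : 1 / 2 ≤ ∑ P ∈ A, ∏ j, ν j (P j) := by
    refine le_trans ?_ (one_sub_le_sum_prod hν0 hν1 hh (mul_pos hT0 hr0) A fun P hP => ?_)
    · have : (Fintype.card κ : ℝ) * n / (T * r) ^ 2 ≤ 1 / 2 := by
        rw [div_le_iff₀ (by positivity), mul_pow, pow_two r, hrr, hT]
        have hc : (0 : ℝ) ≤ Fintype.card κ := Nat.cast_nonneg _
        have : (Fintype.card κ : ℝ) ≤ 1 / 2 * (2 * (Fintype.card κ + 1)) ^ 2 := by nlinarith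
        nlinarith
      linarith
    · have hex : ∃ i, s i * (∑ j, h i (P j) - θ i) ≤ 0 := by
        by_contra! hcon
        exact hP (hA P hcon)
      obtain ⟨i, hi⟩ := hex
      refine ⟨i, ?_⟩
      rw [← one_mul |_|, ← hs i, ← abs_mul]
      refine le_trans ?_ (neg_le_abs _)
      linarith [hfar i, hi]
  have hchi : ∏ j, ∑ ω, ν j ω ^ 2 / μ j ω ≤ Real.exp (T ^ 2 * (B ^ 2 / ε)) := by
    calc ∏ j, ∑ ω, ν j ω ^ 2 / μ j ω ≤ ∏ _j : Fin n, Real.exp ((T / r) ^ 2 * (B ^ 2 / ε)) := by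
          refine Finset.prod_le_prod (fun j _ => Finset.sum_nonneg fun ω _ =>
            div_nonneg (sq_nonneg _) (hε.le.trans (hμ j ω))) fun j _ => ?_
          refine (sum_sq_div_tilt_le hε (T / r) (hμ j) (hμ1 j) hv hvB).trans ?_
          rw [add_comm]
          exact Real.add_one_le_exp _
      _ = Real.exp (T ^ 2 * (B ^ 2 / ε)) := by
          rw [Finset.prod_const, Finset.card_univ, Fintype.card_fin, ← Real.exp_nat_mul, ← hrr]
          congr 1
          field_simp
  have hμA : 0 ≤ ∑ P ∈ A, ∏ j, μ j (P j) :=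
    Finset.sum_nonneg fun P _ => Finset.prod_nonneg fun j _ => hε.le.trans (hμ j _)
  have hcs := sq_sum_prod_le_sum_prod_mul A μ ν fun j ω => hε.trans_le (hμ j ω)
  have hquarter : 1 / 4 ≤ (∑ P ∈ A, ∏ j, μ j (P j)) * Real.exp (T ^ 2 * (B ^ 2 / ε)) := by
    have h1 := mul_le_mul_of_nonneg_left hchi hμA
    nlinarith
  rw [Real.exp_neg, div_le_iff₀ (by norm_num), inv_le_iff_one_le_mul₀ (Real.exp_pos _)]
  linarith

theorem bval_mem_Icc (b : Bool) : bval b ∈ Set.Icc (0 : ℝ) 1 := by cases b <;> simp [bval]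

theorem bval_injective : Function.Injective bval := by
  intro a b; cases a <;> cases b <;> simp [bval]

theorem abs_sgn (b : Bool) : |sgn b| = 1 := by cases b <;> simp [sgn]

theorem sgn_mul_self (b : Bool) : sgn b * sgn b = 1 := by cases b <;> simp [sgn]

theorem sgn_not (b : Bool) : sgn (!b) = -sgn b := by cases b <;> simp [sgn]

theorem mem_Omega_castSucc {p : ℕ} {f : Judg p → Bool} {i : Fin p} {ω : Judg p} :
    ω ∈ Omega p f i.castSucc ↔ ω i = true := by simp [Omega]

theorem mem_Omega_last {p : ℕ} {f : Judg p → Bool} {ω : Judg p} :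
    ω ∈ Omega p f (Fin.last p) ↔ f ω = true := by simp [Omega]

theorem pr_eq_sum {p : ℕ} (f : Judg p → Bool) (π : Judg p → ℝ) (i : Fin (p + 1)) :
    pr p f π i = ∑ ω, π ω * bval (decide (ω ∈ Omega p f i)) := by
  simp [pr, bval]

theorem pr_castSucc {p : ℕ} (f : Judg p → Bool) (π : Judg p → ℝ) (i : Fin p) :
    pr p f π i.castSucc = ∑ ω, π ω * bval (ω i) := by
  simp [pr_eq_sum, mem_Omega_castSucc]

theorem pr_last {p : ℕ} (f : Judg p → Bool) (π : Judg p → ℝ) :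
    pr p f π (Fin.last p) = ∑ ω, π ω * bval (f ω) := by
  simp [pr_eq_sum, mem_Omega_last]

theorem pr_last_of_eq {p : ℕ} {f : Judg p → Bool} {k : Fin p} (hf : ∀ ω, f ω = ω k)
    (π : Judg p → ℝ) : pr p f π (Fin.last p) = pr p f π k.castSucc := by
  simp [pr_last, pr_castSucc, hf]

theorem pr_last_of_eq_not {p : ℕ} {f : Judg p → Bool} {k : Fin p} (hf : ∀ ω, f ω = !(ω k))
    (π : Judg p → ℝ) : pr p f π (Fin.last p) = ∑ ω, π ω - pr p f π k.castSucc := by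
  rw [pr_last, pr_castSucc, ← Finset.sum_sub_distrib]
  refine Finset.sum_congr rfl fun ω _ => ?_
  rw [hf]
  cases ω k <;> simp [bval]

theorem nOnes_eq_sum {p n : ℕ} (f : Judg p → Bool) (P : Fin n → Judg p) (i : Fin (p + 1)) :
    (nOnes p n f P i : ℝ) = ∑ j, bval (decide (P j ∈ Omega p f i)) := by
  simp only [nOnes, Hist, Finset.card_filter, bval]
  rw [Finset.sum_comm]
  simp

theorem quota_eq_of_forall_pos {p n : ℕ} {f : Judg p → Bool} {q : Fin (p + 1) → ℝ}
    {d α : Fin (p + 1) → Bool} {P : Fin n → Judg p}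
    (h : ∀ i, 0 < sgn (α i) * (nOnes p n f P i - q i * n)) : quota p n f q d P = α := by
  funext i
  have hi := h i
  cases hα : α i
  · have hlt : (nOnes p n f P i : ℝ) < q i * n := by
      simp only [hα, sgn, Bool.false_eq_true, if_false] at hi
      linarith
    simp [quota, hlt.not_gt, hlt.ne]
  · have hlt : q i * n < (nOnes p n f P i : ℝ) := by
      simp only [hα, sgn, if_true] at hi
      linarith
    simp [quota, hlt]

theorem Refines.sgn_mul_nonneg {p : ℕ} {f : Judg p → Bool} {q : Fin (p + 1) → ℝ}
    {d α : Fin (p + 1) → Bool} {π : Judg p → ℝ} (h : Refines p f q d π α) (i : Fin (p + 1)) :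
    0 ≤ sgn (α i) * (pr p f π i - q i) := by
  rcases lt_trichotomy (pr p f π i) (q i) with hlt | heq | hgt
  · rw [h i hlt.ne]
    simp [quotaDist, hlt.not_gt, hlt.ne, sgn, hlt.le]
  · simp [heq]
  · rw [h i hgt.ne']
    simp [quotaDist, hgt, sgn, hgt.le]

theorem probParadox_eq_sum_filter {p n : ℕ} (f : Judg p → Bool) (q : Fin (p + 1) → ℝ)
    (d : Fin (p + 1) → Bool) (vπ : Fin n → Judg p → ℝ)
    [DecidablePred (Paradox p n f q d)] :
    probParadox p n f q d vπ
      = ∑ P ∈ Finset.univ.filter (Paradox p n f q d), ∏ j, vπ j (P j) := by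
  rw [probParadox, Finset.sum_filter]
  exact Finset.sum_congr rfl fun P _ => by congr

theorem le_DPmin {p n : ℕ} {f : Judg p → Bool} {q : Fin (p + 1) → ℝ}
    {d : Fin (p + 1) → Bool} {D : Set (Judg p → ℝ)} (hne : D.Nonempty) {c : ℝ}
    (h : ∀ vπ : Fin n → Judg p → ℝ, (∀ j, vπ j ∈ D) → c ≤ probParadox p n f q d vπ) :
    c ≤ DPmin p n f q d D := by
  obtain ⟨π, hπ⟩ := hne
  refine le_csInf ⟨_, fun _ => π, fun _ => hπ, rfl⟩ ?_
  rintro x ⟨vπ, hv, rfl⟩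
  exact h vπ hv

/-- A single paradoxical profile already has probability at least `ε ^ n`. -/
theorem pow_le_probParadox {p n : ℕ} {f : Judg p → Bool} {q : Fin (p + 1) → ℝ}
    {d : Fin (p + 1) → Bool} {vπ : Fin n → Judg p → ℝ} {ε : ℝ} (hε : 0 ≤ ε)
    (hv : ∀ j ω, ε ≤ vπ j ω) {P : Fin n → Judg p} (hP : Paradox p n f q d P) :
    ε ^ n ≤ probParadox p n f q d vπ := by
  classical
  rw [probParadox_eq_sum_filter]
  calc ε ^ n = ∏ _j : Fin n, ε := by simp
    _ ≤ ∏ j, vπ j (P j) := Finset.prod_le_prod (fun _ _ => hε) fun j _ => hv j _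
    _ ≤ _ := Finset.single_le_sum (f := fun P : Fin n → Judg p => ∏ j, vπ j (P j))
        (fun P _ => Finset.prod_nonneg fun j _ => hε.trans (hv j _)) (by simpa using hP)

/-- Smoothed lower bound from a finite family of directions: every inconsistent pattern weakly
met by a distribution must be met, proposition by proposition, either strictly along a common
direction or with a fixed margin. -/
theorem exists_pos_le_DPmin_of_directions {p : ℕ} {f : Judg p → Bool} {q : Fin (p + 1) → ℝ}
    {d : Fin (p + 1) → Bool} {D : Set (Judg p → ℝ)} (hne : D.Nonempty)
    (hsp : StrictlyPositive p D) (hdist : ∀ π ∈ D, IsDistribution p π) {ι : Type*} [Fintype ι]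
    (V : ι → Judg p → ℝ) (hV : ∀ b, ∑ ω, V b ω = 0) {δ : ℝ} (hδ : 0 < δ)
    (hdir : ∀ π, IsDistribution p π → ∀ α, ¬ Consistent p f α →
      (∀ i, 0 ≤ sgn (α i) * (pr p f π i - q i)) →
      ∃ b, ∀ i, 1 ≤ sgn (α i) * pr p f (V b) i ∨ δ ≤ sgn (α i) * (pr p f π i - q i)) :
    ∃ c > (0 : ℝ), ∀ n : ℕ, 1 ≤ n → ¬ kappa1 p n f q d → ¬ kappa3 p n f q d D →
      c ≤ DPmin p n f q d D := by
  classical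
  obtain ⟨ε, hε, hεD⟩ := hsp
  set h : Fin (p + 1) → Judg p → ℝ := fun i ω => bval (decide (ω ∈ Omega p f i))
  obtain ⟨c, hc, N, hN⟩ := exists_pos_le_sum_prod_of_drift (h := h)
    (fun i ω => bval_mem_Icc _) hε hδ (B := ∑ b, ∑ ω, |V b ω|)
  have hε' : 0 < min ε 1 := lt_min hε one_pos
  refine ⟨min c (min ε 1 ^ N), lt_min hc (pow_pos hε' N), fun n hn h1 h3 => ?_⟩
  refine le_DPmin hne fun vπ hv => ?_
  rcases lt_or_ge n N with hlt | hge
  · obtain ⟨P, hP⟩ : ∃ P, Paradox p n f q d P := by simpa [kappa1] using h1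
    exact (min_le_right _ _).trans <| (pow_le_pow_of_le_one hε'.le (min_le_right _ _) hlt.le).trans
      (pow_le_probParadox hε'.le (fun j ω => (min_le_left _ _).trans (hεD _ (hv j) ω)) hP)
  refine (min_le_left _ _).trans ?_
  have hn0 : (0 : ℝ) < n := by exact_mod_cast hn
  set π : Judg p → ℝ := ∑ j, (n : ℝ)⁻¹ • vπ j with hπ
  have hπω : ∀ ω, π ω = (n : ℝ)⁻¹ * ∑ j, vπ j ω := fun ω => by
    simp [hπ, Finset.sum_apply, Finset.mul_sum]
  have hπD : π ∈ convexHull ℝ D :=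
    (convex_convexHull ℝ D).sum_mem (fun _ _ => inv_nonneg.2 hn0.le)
      (by simp [hn0.ne']) fun j _ => subset_convexHull ℝ D (hv j)
  have hπdist : IsDistribution p π := by
    refine ⟨fun ω => ?_, ?_⟩
    · rw [hπω]
      exact mul_nonneg (inv_nonneg.2 hn0.le) (Finset.sum_nonneg fun j _ => (hdist _ (hv j)).1 ω)
    · simp only [hπω, ← Finset.mul_sum]
      rw [Finset.sum_comm]
      simp [fun j => (hdist _ (hv j)).2, hn0.ne']
  have hmean : ∀ i, ∑ j, ∑ ω, vπ j ω * h i ω = n * pr p f π i := fun i => by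
    rw [pr_eq_sum, Finset.sum_comm, Finset.mul_sum]
    refine Finset.sum_congr rfl fun ω _ => ?_
    rw [hπω, ← Finset.sum_mul, mul_assoc, mul_inv_cancel_left₀ hn0.ne']
  have hshift : ∀ (α : Fin (p + 1) → Bool) i, sgn (α i) * (∑ j, ∑ ω, vπ j ω * h i ω - q i * n)
      = n * (sgn (α i) * (pr p f π i - q i)) := fun α i => by rw [hmean]; ring
  obtain ⟨α, ⟨hα, -⟩, hincons⟩ :
      ∃ α, EffRef p n f q d π α ∧ ¬ Consistent p f α := by
    by_contra! hcon
    exact h3 ⟨π, hπD, hcon⟩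
  obtain ⟨b, hb⟩ := hdir π hπdist α hincons hα.sgn_mul_nonneg
  rw [probParadox_eq_sum_filter]
  refine hN n hge vπ (fun j => hεD _ (hv j)) (fun j => (hdist _ (hv j)).2) (V b) (hV b)
    (Finset.single_le_sum (f := fun b => ∑ ω, |V b ω|)
      (fun _ _ => Finset.sum_nonneg fun _ _ => abs_nonneg _) (Finset.mem_univ b))
    (fun i => sgn (α i)) (fun i => q i * n) (fun i => abs_sgn _) (fun i => ?_) (fun i => ?_)
    _ fun P hP => ?_
  · rw [hshift]
    exact mul_nonneg hn0.le (hα.sgn_mul_nonneg i)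
  · rw [hshift, ← pr_eq_sum]
    exact (hb i).imp_right fun hfar => by
      rw [mul_comm]
      exact mul_le_mul_of_nonneg_left hfar hn0.le
  · rw [Finset.mem_filter]
    refine ⟨Finset.mem_univ P, ?_⟩
    rwa [Paradox, quota_eq_of_forall_pos (α := α) fun i => by
      rw [nOnes_eq_sum]
      exact hP i]

/-- The total weights of the premises can be prescribed among vectors of total mass zero. -/
theorem exists_sum_eq_zero_pr_castSucc_eq {p : ℕ} (f : Judg p → Bool) (σ : Fin p → ℝ) :
    ∃ v : Judg p → ℝ, ∑ ω, v ω = 0 ∧ ∀ i : Fin p, pr p f v i.castSucc = σ i := by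
  have key : ∀ g : Judg p → ℝ,
      ∑ ω, (∑ i, σ i * ((Pi.single (fun k => decide (k = i)) 1 : Judg p → ℝ) ω
        - (Pi.single (fun _ => false) 1 : Judg p → ℝ) ω)) * g ω
      = ∑ i, σ i * (g (fun k => decide (k = i)) - g fun _ => false) := fun g => by
    simp only [Finset.sum_mul]
    rw [Finset.sum_comm]
    refine Finset.sum_congr rfl fun i _ => ?_
    simp only [mul_assoc, ← Finset.mul_sum, sub_mul, Finset.sum_sub_distrib, Pi.single_apply,
      ite_mul, one_mul, zero_mul, Finset.sum_ite_eq', Finset.mem_univ, if_true]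
  refine ⟨fun ω => ∑ i, σ i * ((Pi.single (fun k => decide (k = i)) 1 : Judg p → ℝ) ω
    - (Pi.single (fun _ => false) 1 : Judg p → ℝ) ω), ?_, fun i => ?_⟩
  · simpa using key fun _ => 1
  · rw [pr_castSucc]
    refine (key fun ω => bval (ω i)).trans ?_
    simp [bval]

/-- A Boolean function that is affine over the reals is constant, a coordinate, or a negated
coordinate. -/
theorem const_or_coordinate_of_affine {p : ℕ} {f : Judg p → Bool} {a : ℝ} {c : Fin p → ℝ}
    (h : ∀ ω, bval (f ω) = a + ∑ i, c i * bval (ω i)) :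
    (∃ b, ∀ ω, f ω = b) ∨ ∃ i, (∀ ω, f ω = ω i) ∨ ∀ ω, f ω = !(ω i) := by
  have hz : bval (f fun _ => false) = a := by rw [h]; simp [bval]
  have h1 : ∀ i, bval (f fun k => decide (k = i)) = a + c i := fun i => by rw [h]; simp [bval]
  have h2 : ∀ i j, i ≠ j → bval (f fun k => decide (k = i) || decide (k = j)) = a + c i + c j :=
    fun i j hij => by
      have : ∀ k, bval (decide (k = i) || decide (k = j))
          = bval (decide (k = i)) + bval (decide (k = j)) := fun k => by
        by_cases hi : k = i <;> by_cases hj : k = j <;> simp_all [bval]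
      rw [h]
      simp only [this, mul_add, Finset.sum_add_distrib]
      simp [bval, add_assoc]
  by_cases hc : ∃ i, c i ≠ 0
  · obtain ⟨i, hi⟩ := hc
    have hj : ∀ j, j ≠ i → c j = 0 := fun j hji => by
      by_contra hcj
      have e0 := hz
      have ei := h1 i
      have ej := h1 j
      have eij := h2 i j hji.symm
      generalize (f fun _ => false) = x0 at e0
      generalize (f fun k => decide (k = i)) = xi at ei
      generalize (f fun k => decide (k = j)) = xj at ej
      generalize (f fun k => decide (k = i) || decide (k = j)) = xij at eij
      cases x0 <;> cases xi <;> cases xj <;> cases xij <;> simp [bval] at e0 ei ej eij <;>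
        first
        | exact hi (by linarith)
        | exact hcj (by linarith)
    have hf : ∀ ω, bval (f ω) = a + c i * bval (ω i) := fun ω => by
      rw [h, Finset.sum_eq_single i (fun j _ hji => by simp [hj j hji]) (by simp)]
    refine Or.inr ⟨i, ?_⟩
    have e0 := hz
    have ei := h1 i
    generalize (f fun _ => false) = x0 at e0
    generalize (f fun k => decide (k = i)) = xi at ei
    cases x0 <;> cases xi <;> simp [bval] at e0 ei
    · exact absurd (by linarith) hi
    · left
      intro ω
      apply bval_injective
      rw [hf, ← e0, show c i = 1 by linarith]
      ring
    · right
      intro ω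
      apply bval_injective
      rw [hf, ← e0, show c i = -1 by linarith]
      cases ω i <;> simp [bval]
    · exact absurd (by linarith) hi
  · push Not at hc
    refine Or.inl ⟨f fun _ => false, fun ω => bval_injective ?_⟩
    simp [hz, h ω, hc]

/-- Unless the connection is constant or (anti)dictatorial, the weight of the conclusion can be
changed without changing the total mass or the weights of the premises. -/
theorem exists_direction_of_not_coordinate {p : ℕ} {f : Judg p → Bool}
    (hconst : ¬ ∃ b, ∀ ω, f ω = b) (hcoord : ¬ ∃ i, (∀ ω, f ω = ω i) ∨ ∀ ω, f ω = !(ω i)) :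
    ∃ u : Judg p → ℝ, ∑ ω, u ω = 0 ∧ (∀ i : Fin p, pr p f u i.castSucc = 0) ∧
      pr p f u (Fin.last p) = 1 := by
  classical
  let φ : (Judg p → ℝ) → ((Judg p → ℝ) →ₗ[ℝ] ℝ) := fun g => Fintype.linearCombination ℝ g
  have hφ : ∀ g x, φ g x = ∑ ω, x ω * g ω := fun g x => by
    simp [φ, Fintype.linearCombination_apply]
  let L : Option (Fin p) → ((Judg p → ℝ) →ₗ[ℝ] ℝ) := fun o =>
    φ fun ω => o.elim 1 fun i => bval (ω i)
  by_cases hker : (⨅ o, LinearMap.ker (L o)) ≤ LinearMap.ker (φ fun ω => bval (f ω))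
  · obtain ⟨c, hc⟩ := (Submodule.mem_span_range_iff_exists_fun ℝ).1
      (mem_span_of_iInf_ker_le_ker hker)
    have haff : ∀ ω, bval (f ω) = c none + ∑ i, c (some i) * bval (ω i) := fun ω => by
      have := (LinearMap.congr_fun hc (Pi.single ω 1)).symm
      simpa [hφ, L, Pi.single_apply, Fintype.sum_option] using this
    exact ((const_or_coordinate_of_affine haff).elim hconst hcoord).elim
  · obtain ⟨x, hx, hxf⟩ := SetLike.not_le_iff_exists.1 hker
    simp only [Submodule.mem_iInf, LinearMap.mem_ker] at hx hxf
    rw [hφ] at hxf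
    have hscale : ∀ g : Judg p → ℝ, ∑ ω, ((∑ ω, x ω * bval (f ω))⁻¹ • x) ω * g ω
        = (∑ ω, x ω * bval (f ω))⁻¹ * ∑ ω, x ω * g ω := fun g => by
      simp [Finset.mul_sum, mul_assoc]
    refine ⟨(∑ ω, x ω * bval (f ω))⁻¹ • x, ?_, fun i => ?_, ?_⟩
    · have h0 : ∑ ω, x ω = 0 := by simpa [L, hφ] using hx none
      simpa [h0] using hscale fun _ => 1
    · have h0 : ∑ ω, x ω * bval (ω i) = 0 := by simpa [L, hφ] using hx (some i)
      rw [pr_castSucc, hscale, h0, mul_zero]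
    · rw [pr_last, hscale, inv_mul_cancel₀ hxf]

theorem exists_sum_eq_zero_pr_eq {p : ℕ} {f : Judg p → Bool}
    (hconst : ¬ ∃ b, ∀ ω, f ω = b) (hcoord : ¬ ∃ i, (∀ ω, f ω = ω i) ∨ ∀ ω, f ω = !(ω i))
    (σ : Fin (p + 1) → ℝ) : ∃ v : Judg p → ℝ, ∑ ω, v ω = 0 ∧ ∀ i, pr p f v i = σ i := by
  obtain ⟨v, hv, hvσ⟩ := exists_sum_eq_zero_pr_castSucc_eq f fun i => σ i.castSucc
  obtain ⟨u, hu, hu0, hu1⟩ := exists_direction_of_not_coordinate hconst hcoord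
  have hlin : ∀ (t : ℝ) i, pr p f (v + t • u) i = pr p f v i + t * pr p f u i := fun t i => by
    simp [pr, Finset.sum_add_distrib, Finset.mul_sum]
  refine ⟨v + (σ (Fin.last p) - pr p f v (Fin.last p)) • u, ?_, fun i => ?_⟩
  · simp [Finset.sum_add_distrib, ← Finset.mul_sum, hv, hu]
  · rw [hlin]
    induction i using Fin.lastCases with
    | last => rw [hu1]; ring
    | cast i => rw [hvσ, hu0]; ring

/-- For a constant connection, one paradoxical profile makes every profile paradoxical. -/
theorem Paradox.of_const {p n : ℕ} {f : Judg p → Bool} {q : Fin (p + 1) → ℝ}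
    {d : Fin (p + 1) → Bool} {b : Bool} (hf : ∀ ω, f ω = b) {P : Fin n → Judg p}
    (hP : Paradox p n f q d P) (P' : Fin n → Judg p) : Paradox p n f q d P' := by
  have hcount : (nOnes p n f P' (Fin.last p) : ℝ) = nOnes p n f P (Fin.last p) := by
    simp [nOnes_eq_sum, mem_Omega_last, hf]
  have hq : quota p n f q d P' (Fin.last p) = quota p n f q d P (Fin.last p) := by
    simp only [quota, hcount]
  simpa [Paradox, Consistent, hf, hq] using hP

theorem probParadox_eq_one {p n : ℕ} {f : Judg p → Bool} {q : Fin (p + 1) → ℝ}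
    {d : Fin (p + 1) → Bool} {vπ : Fin n → Judg p → ℝ} (hv : ∀ j, IsDistribution p (vπ j))
    (h : ∀ P, Paradox p n f q d P) : probParadox p n f q d vπ = 1 := by
  simp only [probParadox, h, if_true]
  rw [← Fintype.prod_sum]
  simp [fun j => (hv j).2]

/-- A connection determined by one premise, up to the sign `η`, whose thresholds do not match. -/
theorem exists_pos_le_DPmin_of_coordinate {p : ℕ} {f : Judg p → Bool} {q : Fin (p + 1) → ℝ}
    {d : Fin (p + 1) → Bool} {D : Set (Judg p → ℝ)} (hne : D.Nonempty)
    (hsp : StrictlyPositive p D) (hdist : ∀ π ∈ D, IsDistribution p π) (k : Fin p) {η γ : ℝ}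
    (hzero : ∀ v : Judg p → ℝ, ∑ ω, v ω = 0 →
      pr p f v (Fin.last p) = η * pr p f v k.castSucc)
    (hdiff : ∀ π, IsDistribution p π →
      pr p f π (Fin.last p) - q (Fin.last p) = η * (pr p f π k.castSucc - q k.castSucc) + γ)
    (hγ : γ ≠ 0)
    (hα : ∀ α, ¬ Consistent p f α → sgn (α (Fin.last p)) * η = -sgn (α k.castSucc)) :
    ∃ c > (0 : ℝ), ∀ n : ℕ, 1 ≤ n → ¬ kappa1 p n f q d → ¬ kappa3 p n f q d D →
      c ≤ DPmin p n f q d D := by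
  choose V hV0 hV using fun β : Fin p → Bool =>
    exists_sum_eq_zero_pr_castSucc_eq f fun i => sgn (β i)
  refine exists_pos_le_DPmin_of_directions hne hsp hdist V hV0
    (half_pos (abs_pos.2 hγ)) fun π hπ α hincons hpos => ?_
  have hs := hα α hincons
  have hsum : sgn (α k.castSucc) * (pr p f π k.castSucc - q k.castSucc)
      + sgn (α (Fin.last p)) * (pr p f π (Fin.last p) - q (Fin.last p)) = |γ| := by
    have e : sgn (α k.castSucc) * (pr p f π k.castSucc - q k.castSucc)
        + sgn (α (Fin.last p)) * (pr p f π (Fin.last p) - q (Fin.last p))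
        = sgn (α (Fin.last p)) * γ := by
      rw [hdiff π hπ]
      linear_combination (pr p f π k.castSucc - q k.castSucc) * hs
    have hnonneg := e ▸ add_nonneg (hpos k.castSucc) (hpos (Fin.last p))
    rw [e, ← abs_of_nonneg hnonneg, abs_mul, abs_sgn, one_mul]
  by_cases hfar : |γ| / 2 ≤ sgn (α k.castSucc) * (pr p f π k.castSucc - q k.castSucc)
  · refine ⟨Function.update (fun i => α i.castSucc) k (!(α k.castSucc)), fun i => ?_⟩
    induction i using Fin.lastCases with
    | last =>
      left
      rw [hzero _ (hV0 _), hV, Function.update_self, sgn_not, ← mul_assoc, hs, neg_mul_neg,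
        sgn_mul_self]
    | cast i =>
      rcases eq_or_ne i k with rfl | hik
      · exact Or.inr hfar
      · left
        rw [hV, Function.update_of_ne hik, sgn_mul_self]
  · refine ⟨fun i => α i.castSucc, fun i => ?_⟩
    induction i using Fin.lastCases with
    | last =>
      right
      linarith
    | cast i =>
      left
      rw [hV, sgn_mul_self]

/-- if κ4 fails, there is `c > 0` such that whenever κ1(n) and κ3(n) both
fail, `DP^min(n) ≥ c`. -/
theorem stmt_19 (p : ℕ) (hp : 1 ≤ p) (f : Judg p → Bool)
    (q : Fin (p + 1) → ℝ) (hq : ∀ i, q i ∈ Set.Icc (0 : ℝ) 1)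
    (d : Fin (p + 1) → Bool) (D : Set (Judg p → ℝ)) (hne : D.Nonempty)
    (hcl : IsClosed D) (hsp : StrictlyPositive p D)
    (hdist : ∀ π ∈ D, IsDistribution p π) (hk4 : ¬ kappa4 p f q) :
    ∃ c > (0 : ℝ), ∀ n : ℕ, 1 ≤ n → ¬ kappa1 p n f q d → ¬ kappa3 p n f q d D →
      c ≤ DPmin p n f q d D := by
  by_cases hconst : ∃ b, ∀ ω, f ω = b
  · obtain ⟨b, hb⟩ := hconst
    refine ⟨1, one_pos, fun n _ h1 _ => le_DPmin hne fun vπ hv => ?_⟩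
    obtain ⟨P, hP⟩ : ∃ P, Paradox p n f q d P := by simpa [kappa1] using h1
    exact (probParadox_eq_one (fun j => hdist _ (hv j)) fun P' => hP.of_const hb P').ge
  by_cases hcoord : ∃ i, (∀ ω, f ω = ω i) ∨ ∀ ω, f ω = !(ω i)
  · obtain ⟨k, hk | hk⟩ := hcoord
    · refine exists_pos_le_DPmin_of_coordinate hne hsp hdist k (η := 1)
        (γ := q k.castSucc - q (Fin.last p)) (fun v _ => by simp [pr_last_of_eq hk])
        (fun π _ => by rw [pr_last_of_eq hk]; ring)
        (fun h0 => hk4 ⟨k, Or.inl ⟨hk, (sub_eq_zero.1 h0).symm⟩⟩) fun α hincons => ?_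
      rw [Consistent, hk] at hincons
      rw [Bool.eq_not_iff.2 hincons, sgn_not, mul_one]
    · refine exists_pos_le_DPmin_of_coordinate hne hsp hdist k (η := -1)
        (γ := 1 - q k.castSucc - q (Fin.last p))
        (fun v hv => by rw [pr_last_of_eq_not hk, hv]; ring)
        (fun π hπ => by rw [pr_last_of_eq_not hk, hπ.2]; ring)
        (fun h0 => hk4 ⟨k, Or.inr ⟨hk, (sub_eq_zero.1 h0).symm⟩⟩) fun α hincons => ?_
      rw [Consistent, hk] at hincons
      rw [Bool.eq_not_iff.2 hincons, Bool.not_not, mul_neg_one]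
  · choose V hV0 hV using fun α : Fin (p + 1) → Bool =>
      exists_sum_eq_zero_pr_eq hconst hcoord fun i => sgn (α i)
    refine exists_pos_le_DPmin_of_directions hne hsp hdist V hV0 one_pos
      fun π _ α _ _ => ⟨α, fun i => Or.inl ?_⟩
    rw [hV, sgn_mul_self]

end
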